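/- arXiv:1611.04938 — 3 statements merged into one kernel-verified Lean document; each statement's English description precedes it below -/
import Mathlib

section
/- Let u : ℝ³ → ℝ be a smooth function of the variables (x, y, t) and let λ ∈ ℝ, λ ≠ 0. Set A = u_x − λ and B = λ⁻¹ u_y. Then the compatibility (zero-curvature) condition of the overdetermined linear system w_t = A w_x, w_y = B w_x, namely ∂_y A + A ∂_x B = ∂_t B + B ∂_x A, holds at every point of ℝ³ if and only if u satisfies the rdDym equation u_ty = u_x u_xy − u_y u_xx at every point. (Hence the system w_t = (u_x − λ) w_x, w_y = λ⁻¹ u_y w_x is a Lax pair for the rdDym equation.) -/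
noncomputable section

/-- Partial derivative with respect to the first variable (`x`). -/
def Dx (f : ℝ → ℝ → ℝ → ℝ) (x y t : ℝ) : ℝ := deriv (fun x' => f x' y t) x

/-- Partial derivative with respect to the second variable (`y`). -/
def Dy (f : ℝ → ℝ → ℝ → ℝ) (x y t : ℝ) : ℝ := deriv (fun y' => f x y' t) y

/-- Partial derivative with respect to the third variable (`t`). -/
def Dt (f : ℝ → ℝ → ℝ → ℝ) (x y t : ℝ) : ℝ := deriv (fun t' => f x y t') t

/-- Smoothness of a function of three real variables `(x, y, t)`. -/
def Smooth3 (f : ℝ → ℝ → ℝ → ℝ) : Prop :=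
  ContDiff ℝ (⊤ : ℕ∞) (fun p : ℝ × ℝ × ℝ => f p.1 p.2.1 p.2.2)

/-- The derivative of `F` along the curve `c`, by the chain rule. -/
theorem deriv_comp_curve {E G : Type*} [NormedAddCommGroup E] [NormedSpace ℝ E]
    [NormedAddCommGroup G] [NormedSpace ℝ G] {F : E → G} {c : ℝ → E} {v : E} {s : ℝ}
    (hF : DifferentiableAt ℝ F (c s)) (hc : HasDerivAt c v s) :
    deriv (fun r => F (c r)) s = fderiv ℝ F (c s) v :=
  (hF.hasFDerivAt.comp_hasDerivAt s hc).deriv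

/-- The derivative along the curve `c` of a family `L` of linear maps evaluated at `w`. -/
theorem deriv_clm_comp_curve {E G : Type*} [NormedAddCommGroup E] [NormedSpace ℝ E]
    [NormedAddCommGroup G] [NormedSpace ℝ G] {L : E → E →L[ℝ] G} {c : ℝ → E} {v : E} {s : ℝ}
    (hL : DifferentiableAt ℝ L (c s)) (hc : HasDerivAt c v s) (w : E) :
    deriv (fun r => L (c r) w) s = fderiv ℝ L (c s) v w := by
  have h := (hL.hasFDerivAt.comp_hasDerivAt s hc).clm_apply (hasDerivAt_const s w)
  simpa using h.deriv

theorem hasDerivAt_fst_line (x y t : ℝ) :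
    HasDerivAt (fun r : ℝ => (r, y, t)) ((1, 0, 0) : ℝ × ℝ × ℝ) x :=
  (hasDerivAt_id x).prodMk ((hasDerivAt_const x y).prodMk (hasDerivAt_const x t))

theorem hasDerivAt_snd_line (x y t : ℝ) :
    HasDerivAt (fun r : ℝ => (x, r, t)) ((0, 1, 0) : ℝ × ℝ × ℝ) y :=
  (hasDerivAt_const y x).prodMk ((hasDerivAt_id y).prodMk (hasDerivAt_const y t))

/-- Mixed partial derivatives in `x` and `y` of a smooth function commute. -/
theorem Dy_Dx_eq_Dx_Dy {u : ℝ → ℝ → ℝ → ℝ} (hu : Smooth3 u) (x y t : ℝ) :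
    Dy (Dx u) x y t = Dx (Dy u) x y t := by
  unfold Smooth3 at hu
  set F : ℝ × ℝ × ℝ → ℝ := fun p => u p.1 p.2.1 p.2.2
  have hF : Differentiable ℝ F := hu.differentiable (by simp)
  have hF' : Differentiable ℝ (fderiv ℝ F) :=
    (hu.fderiv_right (m := 1) (by norm_cast)).differentiable (by simp)
  have hx : ∀ a b c, Dx u a b c = fderiv ℝ F (a, b, c) (1, 0, 0) := fun a b c =>
    deriv_comp_curve (hF _) (hasDerivAt_fst_line a b c)
  have hy : ∀ a b c, Dy u a b c = fderiv ℝ F (a, b, c) (0, 1, 0) := fun a b c =>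
    deriv_comp_curve (hF _) (hasDerivAt_snd_line a b c)
  have hyx : Dy (Dx u) x y t = fderiv ℝ (fderiv ℝ F) (x, y, t) (0, 1, 0) (1, 0, 0) := by
    simp only [Dy, hx]
    exact deriv_clm_comp_curve (hF' _) (hasDerivAt_snd_line x y t) _
  have hxy : Dx (Dy u) x y t = fderiv ℝ (fderiv ℝ F) (x, y, t) (1, 0, 0) (0, 1, 0) := by
    rw [Dx]
    simp only [hy]
    exact deriv_clm_comp_curve (hF' _) (hasDerivAt_fst_line x y t) _
  rw [hyx, hxy]
  exact (hu.contDiffAt.isSymmSndFDerivAt (by simp; norm_cast)) _ _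

/-- The system `w_t = (u_x - λ) w_x`, `w_y = λ⁻¹ u_y w_x` is compatible iff `u` solves
the rdDym equation `u_ty = u_x u_xy - u_y u_xx`. -/
theorem rdDym_lax_pair_compatibility
    (u : ℝ → ℝ → ℝ → ℝ) (hu : Smooth3 u) (lam : ℝ) (hlam : lam ≠ 0)
    (A B : ℝ → ℝ → ℝ → ℝ)
    (hA : A = fun x y t => Dx u x y t - lam)
    (hB : B = fun x y t => lam⁻¹ * Dy u x y t) :
    (∀ x y t : ℝ,
      Dy A x y t + A x y t * Dx B x y t = Dt B x y t + B x y t * Dx A x y t) ↔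
    (∀ x y t : ℝ, Dt (Dy u) x y t = Dx u x y t * Dx (Dy u) x y t - Dy u x y t * Dx (Dx u) x y t) := by
  have hyA : ∀ x y t, Dy A x y t = Dx (Dy u) x y t := fun x y t => by
    rw [← Dy_Dx_eq_Dx_Dy hu, hA]
    simp [Dy]
  have hxA : ∀ x y t, Dx A x y t = Dx (Dx u) x y t := fun x y t => by
    rw [hA, Dx, Dx, deriv_sub_const]
  have hxB : ∀ x y t, Dx B x y t = lam⁻¹ * Dx (Dy u) x y t := fun x y t => by
    rw [hB, Dx, Dx, deriv_const_mul_field]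
  have htB : ∀ x y t, Dt B x y t = lam⁻¹ * Dt (Dy u) x y t := fun x y t => by
    rw [hB, Dt, Dt, deriv_const_mul_field]
  refine forall_congr' fun x => forall_congr' fun y => forall_congr' fun t => ?_
  rw [hyA, hxA, hxB, htB, hA, hB]
  field_simp
  constructor <;> intro h <;> linarith
end
end

section
/- Let u : ℝ³ → ℝ be a smooth function of (x, y, t) and let λ ∈ ℝ. Set A = λ² − λ u_x − u_y and B = λ − u_x. Then the compatibility condition of the system q_t = A q_x, q_y = B q_x, namely ∂_y A + A ∂_x B = ∂_t B + B ∂_x A, holds at every point of ℝ³ if and only if u satisfies the 3D Pavlov equation u_yy = u_tx + u_y u_xx − u_x u_xy at every point. (Hence q_t = (λ² − λu_x − u_y) q_x, q_y = (λ − u_x) q_x is a Lax pair for the Pavlov equation.) -/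
noncomputable section

/-- The function of `(x, y, t)` seen as a function on the product space. -/
def uncurry3 (f : ℝ → ℝ → ℝ → ℝ) (p : ℝ × ℝ × ℝ) : ℝ := f p.1 p.2.1 p.2.2

theorem Smooth3.hasFDerivAt {f : ℝ → ℝ → ℝ → ℝ} (hf : Smooth3 f) (p : ℝ × ℝ × ℝ) :
    HasFDerivAt (uncurry3 f) (fderiv ℝ (uncurry3 f) p) p :=
  (ContDiff.differentiable hf (by simp) p).hasFDerivAt

theorem Smooth3.hasDerivAt_x {f : ℝ → ℝ → ℝ → ℝ} (hf : Smooth3 f) (x y t : ℝ) :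
    HasDerivAt (fun x' => f x' y t) (fderiv ℝ (uncurry3 f) (x, y, t) (1, 0, 0)) x :=
  HasFDerivAt.comp_hasDerivAt (f := fun s => (s, y, t)) x (hf.hasFDerivAt (x, y, t))
    ((hasDerivAt_id x).prodMk ((hasDerivAt_const x y).prodMk (hasDerivAt_const x t)))

theorem Smooth3.hasDerivAt_y {f : ℝ → ℝ → ℝ → ℝ} (hf : Smooth3 f) (x y t : ℝ) :
    HasDerivAt (fun y' => f x y' t) (fderiv ℝ (uncurry3 f) (x, y, t) (0, 1, 0)) y :=
  HasFDerivAt.comp_hasDerivAt (f := fun s => (x, s, t)) y (hf.hasFDerivAt (x, y, t))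
    ((hasDerivAt_const y x).prodMk ((hasDerivAt_id y).prodMk (hasDerivAt_const y t)))

theorem Smooth3.Dx_eq {f : ℝ → ℝ → ℝ → ℝ} (hf : Smooth3 f) (x y t : ℝ) :
    Dx f x y t = fderiv ℝ (uncurry3 f) (x, y, t) (1, 0, 0) :=
  (hf.hasDerivAt_x x y t).deriv

theorem Smooth3.Dy_eq {f : ℝ → ℝ → ℝ → ℝ} (hf : Smooth3 f) (x y t : ℝ) :
    Dy f x y t = fderiv ℝ (uncurry3 f) (x, y, t) (0, 1, 0) :=
  (hf.hasDerivAt_y x y t).deriv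

theorem Smooth3.hasDerivAt_Dx {f : ℝ → ℝ → ℝ → ℝ} (hf : Smooth3 f) (x y t : ℝ) :
    HasDerivAt (fun x' => f x' y t) (Dx f x y t) x := by
  rw [hf.Dx_eq]
  exact hf.hasDerivAt_x x y t

theorem Smooth3.hasDerivAt_Dy {f : ℝ → ℝ → ℝ → ℝ} (hf : Smooth3 f) (x y t : ℝ) :
    HasDerivAt (fun y' => f x y' t) (Dy f x y t) y := by
  rw [hf.Dy_eq]
  exact hf.hasDerivAt_y x y t

theorem Smooth3.contDiff_fderiv {f : ℝ → ℝ → ℝ → ℝ} (hf : Smooth3 f) :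
    ContDiff ℝ (⊤ : ℕ∞) (fderiv ℝ (uncurry3 f)) :=
  ContDiff.fderiv_right (m := (⊤ : ℕ∞)) hf (by simp)

theorem Smooth3.uncurry3_Dx {f : ℝ → ℝ → ℝ → ℝ} (hf : Smooth3 f) :
    uncurry3 (Dx f) = fun p => fderiv ℝ (uncurry3 f) p (1, 0, 0) :=
  funext fun p => hf.Dx_eq p.1 p.2.1 p.2.2

theorem Smooth3.uncurry3_Dy {f : ℝ → ℝ → ℝ → ℝ} (hf : Smooth3 f) :
    uncurry3 (Dy f) = fun p => fderiv ℝ (uncurry3 f) p (0, 1, 0) :=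
  funext fun p => hf.Dy_eq p.1 p.2.1 p.2.2

theorem Smooth3.smooth3_Dx {f : ℝ → ℝ → ℝ → ℝ} (hf : Smooth3 f) : Smooth3 (Dx f) := by
  change ContDiff ℝ (⊤ : ℕ∞) (uncurry3 (Dx f))
  rw [hf.uncurry3_Dx]
  exact hf.contDiff_fderiv.clm_apply contDiff_const

theorem Smooth3.smooth3_Dy {f : ℝ → ℝ → ℝ → ℝ} (hf : Smooth3 f) : Smooth3 (Dy f) := by
  change ContDiff ℝ (⊤ : ℕ∞) (uncurry3 (Dy f))
  rw [hf.uncurry3_Dy]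
  exact hf.contDiff_fderiv.clm_apply contDiff_const

/-- Mixed partial derivatives of a smooth function commute. -/
theorem Smooth3.Dy_Dx_comm {f : ℝ → ℝ → ℝ → ℝ} (hf : Smooth3 f) (x y t : ℝ) :
    Dy (Dx f) x y t = Dx (Dy f) x y t := by
  have hd : DifferentiableAt ℝ (fderiv ℝ (uncurry3 f)) (x, y, t) :=
    hf.contDiff_fderiv.differentiable (by simp) _
  rw [hf.smooth3_Dx.Dy_eq, hf.smooth3_Dy.Dx_eq, hf.uncurry3_Dx, hf.uncurry3_Dy,
    fderiv_clm_apply hd (differentiableAt_const _),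
    fderiv_clm_apply hd (differentiableAt_const _)]
  have hs : IsSymmSndFDerivAt ℝ (uncurry3 f) (x, y, t) :=
    (ContDiff.contDiffAt hf).isSymmSndFDerivAt (by
      rw [minSmoothness_of_isRCLikeNormedField]
      exact WithTop.coe_le_coe.2 le_top)
  simpa using hs.eq (0, 1, 0) (1, 0, 0)

/-- The system `q_t = (λ² - λ u_x - u_y) q_x`, `q_y = (λ - u_x) q_x` is compatible iff `u`
solves the 3D Pavlov equation `u_yy = u_tx + u_y u_xx - u_x u_xy`. -/
theorem pavlov_lax_pair_compatibility
    (u : ℝ → ℝ → ℝ → ℝ) (hu : Smooth3 u) (lam : ℝ)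
    (A B : ℝ → ℝ → ℝ → ℝ)
    (hA : A = fun x y t => lam ^ 2 - lam * Dx u x y t - Dy u x y t)
    (hB : B = fun x y t => lam - Dx u x y t) :
    (∀ x y t : ℝ,
      Dy A x y t + A x y t * Dx B x y t = Dt B x y t + B x y t * Dx A x y t) ↔
    (∀ x y t : ℝ, Dy (Dy u) x y t = Dt (Dx u) x y t + Dy u x y t * Dx (Dx u) x y t - Dx u x y t * Dx (Dy u) x y t) := by
  subst hA hB
  refine forall_congr' fun x => forall_congr' fun y => forall_congr' fun t => ?_
  have hAy : Dy (fun x y t => lam ^ 2 - lam * Dx u x y t - Dy u x y t) x y t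
      = -(lam * Dx (Dy u) x y t) - Dy (Dy u) x y t := by
    rw [← hu.Dy_Dx_comm]
    exact ((((hu.smooth3_Dx.hasDerivAt_Dy x y t).const_mul lam).const_sub (lam ^ 2)).sub
      (hu.smooth3_Dy.hasDerivAt_Dy x y t)).deriv
  have hAx : Dx (fun x y t => lam ^ 2 - lam * Dx u x y t - Dy u x y t) x y t
      = -(lam * Dx (Dx u) x y t) - Dx (Dy u) x y t :=
    ((((hu.smooth3_Dx.hasDerivAt_Dx x y t).const_mul lam).const_sub (lam ^ 2)).sub
      (hu.smooth3_Dy.hasDerivAt_Dx x y t)).deriv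
  have hBx : Dx (fun x y t => lam - Dx u x y t) x y t = -Dx (Dx u) x y t :=
    ((hu.smooth3_Dx.hasDerivAt_Dx x y t).const_sub lam).deriv
  have hBt : Dt (fun x y t => lam - Dx u x y t) x y t = -Dt (Dx u) x y t :=
    deriv_const_sub lam
  rw [hAy, hAx, hBx, hBt]
  constructor <;> intro h <;> linear_combination -h
end
end

section
/- Let u : ℝ³ → ℝ be a smooth function of (x, y, t) and let λ ∈ ℝ, λ ≠ 0. Set A = λ⁻²(λ u_t − u_y) and B = λ⁻¹ u_y. Then the compatibility condition of the system q_t = A q_x, q_y = B q_x, namely ∂_y A + A ∂_x B = ∂_t B + B ∂_x A, holds at every point of ℝ³ if and only if u satisfies the universal hierarchy equation u_yy = u_t u_xy − u_y u_tx at every point. (Hence q_t = λ⁻²(λ u_t − u_y) q_x, q_y = λ⁻¹ u_y q_x is a Lax pair for the universal hierarchy equation.) -/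
noncomputable section

lemma deriv_comp_eq_fderiv {E : Type*} [NormedAddCommGroup E] [NormedSpace ℝ E]
    {F : E → ℝ} (hF : Differentiable ℝ F) {c : ℝ → E} {v : E} {s : ℝ} (hc : HasDerivAt c v s) :
    deriv (fun s' => F (c s')) s = fderiv ℝ F (c s) v :=
  ((hF (c s)).hasFDerivAt.comp_hasDerivAt s hc).deriv

lemma hasDerivAt_line_x (x y t : ℝ) :
    HasDerivAt (fun s : ℝ => ((s, y, t) : ℝ × ℝ × ℝ)) (1, 0, 0) x :=
  (hasDerivAt_id x).prodMk ((hasDerivAt_const x y).prodMk (hasDerivAt_const x t))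

lemma hasDerivAt_line_y (x y t : ℝ) :
    HasDerivAt (fun s : ℝ => ((x, s, t) : ℝ × ℝ × ℝ)) (0, 1, 0) y :=
  (hasDerivAt_const y x).prodMk ((hasDerivAt_id y).prodMk (hasDerivAt_const y t))

lemma hasDerivAt_line_t (x y t : ℝ) :
    HasDerivAt (fun s : ℝ => ((x, y, s) : ℝ × ℝ × ℝ)) (0, 0, 1) t :=
  (hasDerivAt_const t x).prodMk ((hasDerivAt_const t y).prodMk (hasDerivAt_id t))

namespace Smooth3

variable {f : ℝ → ℝ → ℝ → ℝ}

lemma contDiff (hf : Smooth3 f) : ContDiff ℝ (⊤ : ℕ∞) (uncurry3 f) := hf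

lemma differentiable (hf : Smooth3 f) : Differentiable ℝ (uncurry3 f) :=
  hf.contDiff.differentiable (by simp)

lemma Dx_eq_s2 (hf : Smooth3 f) (x y t : ℝ) :
    Dx f x y t = fderiv ℝ (uncurry3 f) (x, y, t) (1, 0, 0) :=
  deriv_comp_eq_fderiv hf.differentiable (hasDerivAt_line_x x y t)

lemma Dy_eq_s2 (hf : Smooth3 f) (x y t : ℝ) :
    Dy f x y t = fderiv ℝ (uncurry3 f) (x, y, t) (0, 1, 0) :=
  deriv_comp_eq_fderiv hf.differentiable (hasDerivAt_line_y x y t)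

lemma Dt_eq (hf : Smooth3 f) (x y t : ℝ) :
    Dt f x y t = fderiv ℝ (uncurry3 f) (x, y, t) (0, 0, 1) :=
  deriv_comp_eq_fderiv hf.differentiable (hasDerivAt_line_t x y t)

lemma contDiff_fderiv_apply (hf : Smooth3 f) (v : ℝ × ℝ × ℝ) :
    ContDiff ℝ (⊤ : ℕ∞) fun p => fderiv ℝ (uncurry3 f) p v :=
  (hf.contDiff.fderiv_right (m := (⊤ : ℕ∞)) (by simp)).clm_apply contDiff_const

lemma uncurry3_Dx_s2 (hf : Smooth3 f) :
    uncurry3 (Dx f) = fun p => fderiv ℝ (uncurry3 f) p (1, 0, 0) :=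
  funext fun p => hf.Dx_eq_s2 p.1 p.2.1 p.2.2

lemma uncurry3_Dy_s2 (hf : Smooth3 f) :
    uncurry3 (Dy f) = fun p => fderiv ℝ (uncurry3 f) p (0, 1, 0) :=
  funext fun p => hf.Dy_eq_s2 p.1 p.2.1 p.2.2

lemma uncurry3_Dt (hf : Smooth3 f) :
    uncurry3 (Dt f) = fun p => fderiv ℝ (uncurry3 f) p (0, 0, 1) :=
  funext fun p => hf.Dt_eq p.1 p.2.1 p.2.2

lemma smooth3_Dx_s2 (hf : Smooth3 f) : Smooth3 (Dx f) := by
  change ContDiff ℝ _ (uncurry3 (Dx f))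
  rw [hf.uncurry3_Dx_s2]
  exact hf.contDiff_fderiv_apply _

lemma smooth3_Dy_s2 (hf : Smooth3 f) : Smooth3 (Dy f) := by
  change ContDiff ℝ _ (uncurry3 (Dy f))
  rw [hf.uncurry3_Dy_s2]
  exact hf.contDiff_fderiv_apply _

lemma smooth3_Dt (hf : Smooth3 f) : Smooth3 (Dt f) := by
  change ContDiff ℝ _ (uncurry3 (Dt f))
  rw [hf.uncurry3_Dt]
  exact hf.contDiff_fderiv_apply _

lemma fderiv_fderiv_apply_comm (hf : Smooth3 f) (p v w : ℝ × ℝ × ℝ) :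
    fderiv ℝ (fun q => fderiv ℝ (uncurry3 f) q v) p w =
      fderiv ℝ (fun q => fderiv ℝ (uncurry3 f) q w) p v := by
  have hd : DifferentiableAt ℝ (fderiv ℝ (uncurry3 f)) p :=
    (hf.contDiff.fderiv_right (m := (⊤ : ℕ∞)) (by simp)).differentiable (by simp) p
  have key (a b : ℝ × ℝ × ℝ) : fderiv ℝ (fun q => fderiv ℝ (uncurry3 f) q a) p b =
      fderiv ℝ (fderiv ℝ (uncurry3 f)) p b a := by
    simp [fderiv_clm_apply hd (differentiableAt_const a)]
  rw [key, key]
  exact (hf.contDiff.contDiffAt.isSymmSndFDerivAt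
    (by
      rw [minSmoothness_of_isRCLikeNormedField]
      exact WithTop.coe_le_coe.2 (le_top : (2 : ℕ∞) ≤ ⊤))) w v

lemma Dx_Dt_comm (hf : Smooth3 f) (x y t : ℝ) : Dx (Dt f) x y t = Dt (Dx f) x y t := by
  rw [hf.smooth3_Dt.Dx_eq_s2, hf.smooth3_Dx_s2.Dt_eq, hf.uncurry3_Dt, hf.uncurry3_Dx_s2,
    hf.fderiv_fderiv_apply_comm]

lemma Dy_Dt_comm (hf : Smooth3 f) (x y t : ℝ) : Dy (Dt f) x y t = Dt (Dy f) x y t := by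
  rw [hf.smooth3_Dt.Dy_eq_s2, hf.smooth3_Dy_s2.Dt_eq, hf.uncurry3_Dt, hf.uncurry3_Dy_s2,
    hf.fderiv_fderiv_apply_comm]

lemma differentiableAt_line_x (hf : Smooth3 f) (x y t : ℝ) :
    DifferentiableAt ℝ (fun s => f s y t) x :=
  DifferentiableAt.comp (g := uncurry3 f) x (hf.differentiable (x, y, t))
    (hasDerivAt_line_x x y t).differentiableAt

lemma differentiableAt_line_y (hf : Smooth3 f) (x y t : ℝ) :
    DifferentiableAt ℝ (fun s => f x s t) y :=
  DifferentiableAt.comp (g := uncurry3 f) y (hf.differentiable (x, y, t))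
    (hasDerivAt_line_y x y t).differentiableAt

end Smooth3

/-- The system `q_t = λ⁻²(λ u_t - u_y) q_x`, `q_y = λ⁻¹ u_y q_x` is compatible iff `u`
solves the universal hierarchy equation `u_yy = u_t u_xy - u_y u_tx`. -/
theorem uhe_lax_pair_compatibility
    (u : ℝ → ℝ → ℝ → ℝ) (hu : Smooth3 u) (lam : ℝ) (hlam : lam ≠ 0)
    (A B : ℝ → ℝ → ℝ → ℝ)
    (hA : A = fun x y t => (lam ^ 2)⁻¹ * (lam * Dt u x y t - Dy u x y t))
    (hB : B = fun x y t => lam⁻¹ * Dy u x y t) :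
    (∀ x y t : ℝ,
      Dy A x y t + A x y t * Dx B x y t = Dt B x y t + B x y t * Dx A x y t) ↔
    (∀ x y t : ℝ, Dy (Dy u) x y t = Dt u x y t * Dx (Dy u) x y t - Dy u x y t * Dt (Dx u) x y t) := by
  have hut := hu.smooth3_Dt
  have huy := hu.smooth3_Dy_s2
  have hAy (x y t : ℝ) :
      Dy A x y t = (lam ^ 2)⁻¹ * (lam * Dt (Dy u) x y t - Dy (Dy u) x y t) := by
    rw [← hu.Dy_Dt_comm, hA]
    exact ((((hut.differentiableAt_line_y x y t).hasDerivAt.const_mul lam).sub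
      (huy.differentiableAt_line_y x y t).hasDerivAt).const_mul _).deriv
  have hAx (x y t : ℝ) :
      Dx A x y t = (lam ^ 2)⁻¹ * (lam * Dt (Dx u) x y t - Dx (Dy u) x y t) := by
    rw [← hu.Dx_Dt_comm, hA]
    exact ((((hut.differentiableAt_line_x x y t).hasDerivAt.const_mul lam).sub
      (huy.differentiableAt_line_x x y t).hasDerivAt).const_mul _).deriv
  have hBx (x y t : ℝ) : Dx B x y t = lam⁻¹ * Dx (Dy u) x y t := by
    rw [hB]
    exact deriv_const_mul_field _
  have hBt (x y t : ℝ) : Dt B x y t = lam⁻¹ * Dt (Dy u) x y t := by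
    rw [hB]
    exact deriv_const_mul_field _
  refine forall₃_congr fun x y t => ?_
  rw [hAy, hAx, hBx, hBt, hA, hB]
  field_simp
  refine ⟨fun h => mul_left_cancel₀ hlam ?_, fun h => ?_⟩
  · linear_combination -h
  · linear_combination -lam * h
end
end
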